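/- arXiv:2502.06013 — 2 statements merged into one kernel-verified Lean document; each statement's English description precedes it below -/
import Mathlib

section
/- A simple graph G on n ≥ 3 vertices is expelling if and only if G is bipartite. -/
open scoped Classical

/-- The state space `Ξₙ` for a graph on vertex set `V` with `n = |V|`: a state `(v, i, ε)`
consists of a bijection `v` from the vertices to the positions `ℤ/n` (the replica of vertex
`a` sits at position `v a`; positions increase clockwise), the index `i : ℤ/n`, and the
orientation `ε ∈ {±1}` encoded as a `Bool` (`true` = `+1`, `false` = `-1`). -/
abbrev Xi (V : Type*) [Fintype V] : Type _ :=
  (V ≃ ZMod (Fintype.card V)) × ZMod (Fintype.card V) × Bool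

/-- The orientation `ε` as an element of `ℤ/n`. -/
def epsZ (n : ℕ) (e : Bool) : ZMod n := if e then 1 else -1

/-- Refractive toric promotion `Θ_G`:
`Θ_G (v,i,ε) = (s̄ᵢ v, i+ε, ε)` if `{v⁻¹(i), v⁻¹(i+1)}` is not an edge of `G`, and
`Θ_G (v,i,ε) = (s̄ᵢ v, i−ε, −ε)` if it is an edge of `G`.  Here `s̄ᵢ v` swaps the replicas
sitting at positions `i` and `i+1`. -/
noncomputable def theta {V : Type*} [Fintype V] (G : SimpleGraph V) (D : Xi V) : Xi V :=
  if G.Adj (D.1.symm D.2.1) (D.1.symm (D.2.1 + 1)) then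
    (D.1.trans (Equiv.swap D.2.1 (D.2.1 + 1)), D.2.1 - epsZ _ D.2.2, !D.2.2)
  else
    (D.1.trans (Equiv.swap D.2.1 (D.2.1 + 1)), D.2.1 + epsZ _ D.2.2, D.2.2)

/-- The net number of clockwise steps that the replica of vertex `a` makes during one
application of `Θ_G` to the state `D`: each application swaps the replicas at positions
`i` and `i+1`, moving the former one step clockwise and the latter one step
counterclockwise. -/
def disp {V : Type*} [Fintype V] (D : Xi V) (a : V) : ℤ :=
  if D.1 a = D.2.1 then 1 else if D.1 a = D.2.1 + 1 then -1 else 0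

/-- `n` times the winding number `w_O(a)` of vertex `a` with respect to the orbit `O` of the
state `D` under `Θ_G`: the net number of clockwise steps made by the replica of `a` during
`P` consecutive applications of `Θ_G` starting from `D`, where `P` is the size of the orbit
(i.e. the minimal period of `D`).  The winding number itself is `windSum G D a / n`; in
particular `w_O(a) = 0` iff `windSum G D a = 0`, and `w_O(a) = w_O(b)` iff
`windSum G D a = windSum G D b`. -/
noncomputable def windSum {V : Type*} [Fintype V] (G : SimpleGraph V) (D : Xi V) (a : V) : ℤ :=
  ∑ k ∈ Finset.range (Function.minimalPeriod (theta G) D), disp ((theta G)^[k] D) a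

/-- The winding vector of the orbit of `D` under `Θ_G` is zero. -/
def WindingVectorZero {V : Type*} [Fintype V] (G : SimpleGraph V) (D : Xi V) : Prop :=
  ∀ a : V, windSum G D a = 0

/-- `G` is ensnaring if every orbit of `Θ_G` has winding vector `0`. -/
def Ensnaring {V : Type*} [Fintype V] (G : SimpleGraph V) : Prop :=
  ∀ D : Xi V, WindingVectorZero G D

/-- `G` is expelling if no orbit of `Θ_G` has winding vector `0`. -/
def Expelling {V : Type*} [Fintype V] (G : SimpleGraph V) : Prop :=
  ∀ D : Xi V, ¬ WindingVectorZero G D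

section Expel
variable {V : Type*} [Fintype V]

def revS (D : Xi V) : Xi V := (D.1, D.2.1 - epsZ _ D.2.2, !D.2.2)

lemma epsZ_not (n : ℕ) (e : Bool) : epsZ n (!e) = - epsZ n e := by
  cases e <;> simp [epsZ]

lemma revS_revS (D : Xi V) : revS (revS D) = D := by
  obtain ⟨v, i, e⟩ := D
  simp [revS, epsZ_not]

lemma theta_adj (G : SimpleGraph V) (D : Xi V)
    (h : G.Adj (D.1.symm D.2.1) (D.1.symm (D.2.1 + 1))) :
    theta G D = (D.1.trans (Equiv.swap D.2.1 (D.2.1 + 1)), D.2.1 - epsZ _ D.2.2, !D.2.2) := by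
  unfold theta; rw [if_pos h]

lemma theta_nadj (G : SimpleGraph V) (D : Xi V)
    (h : ¬ G.Adj (D.1.symm D.2.1) (D.1.symm (D.2.1 + 1))) :
    theta G D = (D.1.trans (Equiv.swap D.2.1 (D.2.1 + 1)), D.2.1 + epsZ _ D.2.2, D.2.2) := by
  unfold theta; rw [if_neg h]

lemma theta_rev (G : SimpleGraph V) (D : Xi V) : theta G (revS (theta G D)) = revS D := by
  obtain ⟨v, i, e⟩ := D
  by_cases h : G.Adj (v.symm i) (v.symm (i + 1))
  · rw [theta_adj G (v, i, e) h]
    rw [theta_adj]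
    · simp [revS, epsZ_not, Equiv.trans_assoc]
    · simpa [revS, epsZ_not] using h.symm
  · rw [theta_nadj G (v, i, e) h]
    rw [theta_nadj]
    · simp [revS, epsZ_not, Equiv.trans_assoc, sub_eq_add_neg]
    · simpa [revS, epsZ_not, G.adj_comm] using h

lemma theta_inj (G : SimpleGraph V) : Function.Injective (theta G) := by
  intro D D' h
  have := theta_rev G D
  rw [h, theta_rev] at this
  rw [← revS_revS D, ← revS_revS D', this]

lemma period_pos [Nonempty V] (G : SimpleGraph V) (D : Xi V) :
    0 < Function.minimalPeriod (theta G) D := by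
  have : NeZero (Fintype.card V) := ⟨Fintype.card_ne_zero⟩
  have : Finite (Xi V) := by unfold Xi; infer_instance
  exact Function.minimalPeriod_pos_of_mem_periodicPts ((theta_inj G).mem_periodicPts D)

def act (D : Xi V) : V := if D.2.2 then D.1.symm D.2.1 else D.1.symm (D.2.1 + 1)

def sgn (e : Bool) : ℤ := if e then 1 else -1

lemma ne_succ (hn : 2 ≤ Fintype.card V) (i : ZMod (Fintype.card V)) : i ≠ i + 1 := by
  have : Fact (1 < Fintype.card V) := ⟨hn⟩
  intro h
  exact one_ne_zero (left_eq_add.mp h)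

lemma act_nadj (G : SimpleGraph V) (D : Xi V)
    (h : ¬ G.Adj (D.1.symm D.2.1) (D.1.symm (D.2.1 + 1))) :
    act (theta G D) = act D := by
  rw [theta_nadj G _ h]
  obtain ⟨v, i, e⟩ := D
  cases e <;> simp [act, epsZ]

lemma act_adj (G : SimpleGraph V) (D : Xi V)
    (h : G.Adj (D.1.symm D.2.1) (D.1.symm (D.2.1 + 1))) :
    G.Adj (act D) (act (theta G D)) := by
  rw [theta_adj G _ h]
  obtain ⟨v, i, e⟩ := D
  cases e
  · simpa [act, epsZ] using h.symm
  · simpa [act, epsZ] using h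

lemma disp_act (hn : 2 ≤ Fintype.card V) (D : Xi V) : disp D (act D) = sgn D.2.2 := by
  obtain ⟨v, i, e⟩ := D
  have := ne_succ hn i
  cases e <;> simp [act, disp, sgn, this.symm]

def wt (f : V → Bool) (a : V) : ℤ := if f a then 1 else 0

lemma sum_disp (hn : 2 ≤ Fintype.card V) (D : Xi V) (w : V → ℤ) :
    ∑ a, w a * disp D a = w (D.1.symm D.2.1) - w (D.1.symm (D.2.1 + 1)) := by
  have hne := ne_succ hn D.2.1
  have : ∀ a, w a * disp D a = (if a = D.1.symm D.2.1 then w a else 0)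
      - (if a = D.1.symm (D.2.1 + 1) then w a else 0) := by
    intro a
    unfold disp
    rw [Equiv.eq_symm_apply, Equiv.eq_symm_apply]
    by_cases h1 : D.1 a = D.2.1
    · simp [h1, hne]
    · by_cases h2 : D.1 a = D.2.1 + 1
      · simp [h1, h2, hne.symm]
      · simp [h1, h2]
  simp only [this, Finset.sum_sub_distrib, Finset.sum_ite_eq', Finset.mem_univ, if_true]

lemma not_zero_of_inv (hn : 2 ≤ Fintype.card V) (G : SimpleGraph V) (f : V → Bool)
    (hf : ∀ a b, G.Adj a b → f a ≠ f b) (D : Xi V) (hD : f (act D) = D.2.2) :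
    ¬ WindingVectorZero G D := by
  intro hz
  have : Nonempty V := Fintype.card_pos_iff.mp (by omega)
  have hP := period_pos G D
  have inv : ∀ k, f (act ((theta G)^[k] D)) = ((theta G)^[k] D).2.2 := by
    intro k
    induction k with
    | zero => exact hD
    | succ k ih =>
      rw [Function.iterate_succ_apply']
      generalize (theta G)^[k] D = E at *
      by_cases h : G.Adj (E.1.symm E.2.1) (E.1.symm (E.2.1 + 1))
      · have h2 := hf _ _ (act_adj G E h)
        rw [ih] at h2
        have h3 : (theta G E).2.2 = !E.2.2 := by rw [theta_adj G E h]
        rw [h3]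
        revert h2
        cases E.2.2 <;> cases f (act (theta G E)) <;> simp
      · rw [act_nadj G E h, ih, theta_nadj G E h]
  have hnn : ∀ E : Xi V, f (act E) = E.2.2 → 0 ≤ ∑ a, wt f a * disp E a ∧
      (G.Adj (E.1.symm E.2.1) (E.1.symm (E.2.1 + 1)) → 0 < ∑ a, wt f a * disp E a) := by
    intro E hE
    rw [sum_disp hn]
    have h4 := hf (E.1.symm E.2.1) (E.1.symm (E.2.1 + 1))
    obtain ⟨v, i, e⟩ := E
    unfold wt
    cases e <;> simp only [act] at hE <;> simp at hE <;> simp only [hE] at h4 ⊢ <;>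
      cases hh : f (v.symm i) <;> cases hh' : f (v.symm (i+1)) <;> simp_all
  have hsum : ∑ k ∈ Finset.range (Function.minimalPeriod (theta G) D),
      ∑ a, wt f a * disp ((theta G)^[k] D) a = 0 := by
    rw [Finset.sum_comm]
    apply Finset.sum_eq_zero
    intro a _
    rw [← Finset.mul_sum]
    have := hz a
    unfold windSum at this
    rw [this, mul_zero]
  rw [Finset.sum_eq_zero_iff_of_nonneg (fun k _ => (hnn _ (inv k)).1)] at hsum
  have hno : ∀ k < Function.minimalPeriod (theta G) D,
      ¬ G.Adj (((theta G)^[k] D).1.symm ((theta G)^[k] D).2.1)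
        (((theta G)^[k] D).1.symm (((theta G)^[k] D).2.1 + 1)) := by
    intro k hk h
    have := (hnn _ (inv k)).2 h
    rw [hsum k (Finset.mem_range.mpr hk)] at this
    exact lt_irrefl _ this
  have hc : ∀ k ≤ Function.minimalPeriod (theta G) D,
      act ((theta G)^[k] D) = act D ∧ ((theta G)^[k] D).2.2 = D.2.2 := by
    intro k
    induction k with
    | zero => intro _; exact ⟨rfl, rfl⟩
    | succ k ih =>
      intro hk
      have h1 := ih (by omega)
      have h2 := hno k (by omega)
      rw [Function.iterate_succ_apply']
      refine ⟨(act_nadj G _ h2).trans h1.1, ?_⟩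
      rw [theta_nadj G _ h2]; exact h1.2
  have h5 := hz (act D)
  unfold windSum at h5
  rw [Finset.sum_congr rfl (g := fun _ => sgn D.2.2)] at h5
  · simp [sgn] at h5
    have h6 : Function.minimalPeriod (theta G) D ≠ 0 := by omega
    split_ifs at h5 <;> omega
  · intro k hk
    have := hc k (Finset.mem_range.mp hk).le
    rw [← this.1, disp_act hn, this.2]

lemma expelling_of_col (hn : 2 ≤ Fintype.card V) (G : SimpleGraph V) (h : G.Colorable 2) :
    Expelling G := by
  obtain ⟨C⟩ := h
  intro D
  let f : V → Bool := fun a => decide (C a = 0)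
  have hf : ∀ a b, G.Adj a b → f a ≠ f b := by
    intro a b hab
    have := C.valid hab
    simp only [f, ne_eq, decide_eq_decide]
    revert this
    generalize C a = x
    generalize C b = y
    revert x y
    decide
  by_cases hD : f (act D) = D.2.2
  · exact not_zero_of_inv hn G f hf D hD
  · apply not_zero_of_inv hn G (fun a => !(f a))
    · intro a b hab
      have := hf a b hab
      simpa using this
    · revert hD
      cases D.2.2 <;> cases f (act D) <;> simp
end Expel
section Confine
variable {V : Type*} [Fintype V]

/-- one application of theta that does not wrap around -/
def NW (G : SimpleGraph V) (D D' : Xi V) : Prop :=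
  D.2.1.val + 1 < Fintype.card V ∧ theta G D = D'

lemma theta_fst (G : SimpleGraph V) (D : Xi V) :
    (theta G D).1 = D.1.trans (Equiv.swap D.2.1 (D.2.1 + 1)) := by
  unfold theta; split_ifs <;> rfl

lemma NW_disp (G : SimpleGraph V) (D : Xi V) (h : D.2.1.val + 1 < Fintype.card V) (a : V) :
    disp D a = (((theta G D).1 a).val : ℤ) - ((D.1 a).val : ℤ) := by
  have hne := ne_succ (V := V) (by omega) D.2.1
  have hv : (D.2.1 + 1).val = D.2.1.val + 1 := by
    have : Fact (1 < Fintype.card V) := ⟨by omega⟩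
    rw [ZMod.val_add_of_lt, ZMod.val_one]
    rwa [ZMod.val_one]
  rw [theta_fst, Equiv.trans_apply]
  unfold disp
  by_cases h1 : D.1 a = D.2.1
  · rw [if_pos h1, h1, Equiv.swap_apply_left, hv]; push_cast; ring
  · rw [if_neg h1]
    by_cases h2 : D.1 a = D.2.1 + 1
    · rw [if_pos h2, h2, Equiv.swap_apply_right, hv]; push_cast; ring
    · rw [if_neg h2, Equiv.swap_apply_of_ne_of_ne h1 h2]; ring

lemma NW_trans (G : SimpleGraph V) (D D' : Xi V) (h : Relation.TransGen (NW G) D D') :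
    ∃ N, 0 < N ∧ (theta G)^[N] D = D' ∧ ∀ a, ∑ k ∈ Finset.range N, disp ((theta G)^[k] D) a =
      ((D'.1 a).val : ℤ) - ((D.1 a).val : ℤ) := by
  induction h with
  | single h =>
    refine ⟨1, one_pos, h.2, fun a => ?_⟩
    rw [← h.2, ← NW_disp G D h.1]; simp
  | tail _ h ih =>
    obtain ⟨N, _, h1, h2⟩ := ih
    refine ⟨N + 1, by omega, ?_, fun a => ?_⟩
    · rw [Function.iterate_succ_apply', h1, h.2]
    · rw [Finset.sum_range_succ, h2, h1, NW_disp G _ h.1, h.2]; ring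

lemma sum_periodic (G : SimpleGraph V) (D : Xi V) (a : V) (q : ℕ) :
    ∑ k ∈ Finset.range (Function.minimalPeriod (theta G) D * q), disp ((theta G)^[k] D) a =
      q * windSum G D a := by
  induction q with
  | zero => simp
  | succ q ih =>
    rw [mul_add, mul_one, Finset.sum_range_add, ih]
    have : ∀ k, (theta G)^[Function.minimalPeriod (theta G) D * q + k] D = (theta G)^[k] D := by
      intro k
      rw [add_comm, Function.iterate_add_apply]
      congr 1
      exact (Function.isPeriodicPt_minimalPeriod (theta G) D).mul_const q
    simp only [this]
    unfold windSum
    push_cast; ring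

lemma wind_zero (G : SimpleGraph V) (D : Xi V) (h : Relation.TransGen (NW G) D D) :
    WindingVectorZero G D := by
  intro a
  obtain ⟨N, h0, h1, h2⟩ := NW_trans G D D h
  have hp : Function.IsPeriodicPt (theta G) N D := h1
  obtain ⟨q, hq⟩ := hp.minimalPeriod_dvd
  have h3 := h2 a
  rw [hq, sum_periodic, sub_self] at h3
  rcases mul_eq_zero.mp h3 with h4 | h4
  · have : q = 0 := by exact_mod_cast h4
    subst this; omega
  · exact h4

/-- zippers: reversed left part, active element, right part, direction -/
abbrev Zip (V : Type*) := List V × V × List V × Bool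

def Zip.list (z : Zip V) : List V := z.1.reverse ++ z.2.1 :: z.2.2.1

inductive ZStep (G : SimpleGraph V) : Zip V → Zip V → Prop
  | rn (L a b R) : ¬ G.Adj a b → ZStep G (L, a, b :: R, true) (b :: L, a, R, true)
  | ra (L a b R) : G.Adj a b → ZStep G (L, a, b :: R, true) (L, b, a :: R, false)
  | ln (L a b R) : ¬ G.Adj a b → ZStep G (b :: L, a, R, false) (L, a, b :: R, false)
  | la (L a b R) : G.Adj a b → ZStep G (b :: L, a, R, false) (a :: L, b, R, true)

def PL (v : V ≃ ZMod (Fintype.card V)) (l : List V) : Prop :=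
  l.length = Fintype.card V ∧ ∀ (k : ℕ) x, l[k]? = some x → v x = (k : ZMod (Fintype.card V))

lemma PL_swap (v : V ≃ ZMod (Fintype.card V)) (A R : List V) (a b : V)
    (h : PL v (A ++ a :: b :: R)) :
    PL (v.trans (Equiv.swap (A.length : ZMod (Fintype.card V)) (A.length + 1)))
      (A ++ b :: a :: R) := by
  have hlen := h.1
  simp at hlen
  refine ⟨by simpa using hlen, fun k x hk => ?_⟩
  have ha : v a = A.length := h.2 A.length a (by simp)
  have hb : v b = A.length + 1 := by
    have := h.2 (A.length + 1) b (by simp)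
    simpa using this
  have hkl : k < Fintype.card V := by
    have := (List.getElem?_eq_some_iff.mp hk).1
    simp at this; omega
  have hcast : ∀ j < Fintype.card V, (k : ZMod (Fintype.card V)) = (j : ℕ) → k = j := by
    intro j hj e
    rw [ZMod.natCast_eq_natCast_iff'] at e
    rwa [Nat.mod_eq_of_lt hkl, Nat.mod_eq_of_lt hj] at e
  rw [Equiv.trans_apply]
  by_cases h1 : k = A.length
  · subst h1
    simp at hk
    rw [← hk, hb, Equiv.swap_apply_right]
  · by_cases h2 : k = A.length + 1
    · subst h2
      simp at hk
      rw [← hk, ha, Equiv.swap_apply_left]; push_cast; rfl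
    · have h3 : (A ++ a :: b :: R)[k]? = some x := by
        rw [← hk]
        rcases lt_or_ge k A.length with h4 | h4
        · rw [List.getElem?_append_left h4, List.getElem?_append_left h4]
        · rw [List.getElem?_append_right h4, List.getElem?_append_right h4]
          obtain ⟨j, hj⟩ : ∃ j, k - A.length = j + 2 := ⟨k - A.length - 2, by omega⟩
          rw [hj]; simp
      rw [h.2 k x h3, Equiv.swap_apply_of_ne_of_ne]
      · intro e; exact h1 (hcast _ (by omega) e)
      · intro e; exact h2 (hcast _ (by omega) (by push_cast; exact e))

def ZRel (D : Xi V) (z : Zip V) : Prop :=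
  PL D.1 z.list ∧ D.2.2 = z.2.2.2 ∧
    (if z.2.2.2 then D.2.1 = z.1.length else D.2.1 + 1 = z.1.length)

lemma PL_symm {v : V ≃ ZMod (Fintype.card V)} {A R : List V} {a b : V}
    (h : PL v (A ++ a :: b :: R)) :
    v.symm (A.length) = a ∧ v.symm (A.length + 1) = b ∧
      ((A.length : ZMod (Fintype.card V))).val + 1 < Fintype.card V := by
  have hlen := h.1
  simp at hlen
  have ha : v a = A.length := h.2 A.length a (by simp)
  have hb : v b = A.length + 1 := by
    have := h.2 (A.length + 1) b (by simp)
    simpa using this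
  refine ⟨by rw [← ha]; simp, by rw [← hb]; simp, ?_⟩
  rw [ZMod.val_natCast, Nat.mod_eq_of_lt] <;> omega

lemma ZStep_NW (G : SimpleGraph V) (D : Xi V) (z z' : Zip V) (h : ZRel D z) (hs : ZStep G z z') :
    ∃ D', NW G D D' ∧ ZRel D' z' := by
  refine ⟨theta G D, ?_⟩
  obtain ⟨v, i, e⟩ := D
  cases hs with
  | rn L a b R hab =>
    obtain ⟨h1, h2, h3⟩ := h
    simp only [Zip.list, if_true] at h1 h2 h3
    have h4 := PL_symm h1
    have h5 := PL_swap v _ _ _ _ h1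
    rw [List.length_reverse] at h4 h5
    subst h3; subst h2
    refine ⟨⟨h4.2.2, rfl⟩, ?_⟩
    rw [theta_nadj]
    · refine ⟨?_, rfl, ?_⟩
      · simpa [Zip.list] using h5
      · simp [epsZ]
    · simp only; rw [h4.1, h4.2.1]; exact hab
  | ra L a b R hab =>
    obtain ⟨h1, h2, h3⟩ := h
    simp only [Zip.list, if_true] at h1 h2 h3
    have h4 := PL_symm h1
    have h5 := PL_swap v _ _ _ _ h1
    rw [List.length_reverse] at h4 h5
    subst h3; subst h2
    refine ⟨⟨h4.2.2, rfl⟩, ?_⟩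
    rw [theta_adj]
    · refine ⟨?_, rfl, ?_⟩
      · simpa [Zip.list] using h5
      · simp [epsZ]
    · simp only; rw [h4.1, h4.2.1]; exact hab
  | ln L a b R hab =>
    obtain ⟨h1, h2, h3⟩ := h
    simp [Zip.list] at h1 h2 h3
    have h4 := PL_symm h1
    have h5 := PL_swap v _ _ _ _ h1
    rw [List.length_reverse] at h4 h5
    subst h3; subst h2
    refine ⟨⟨h4.2.2, rfl⟩, ?_⟩
    rw [theta_nadj]
    · refine ⟨?_, rfl, ?_⟩
      · simpa [Zip.list] using h5
      · simp [epsZ]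
    · simp only; rw [h4.1, h4.2.1, G.adj_comm]; exact hab
  | la L a b R hab =>
    obtain ⟨h1, h2, h3⟩ := h
    simp [Zip.list] at h1 h2 h3
    have h4 := PL_symm h1
    have h5 := PL_swap v _ _ _ _ h1
    rw [List.length_reverse] at h4 h5
    subst h3; subst h2
    refine ⟨⟨h4.2.2, rfl⟩, ?_⟩
    rw [theta_adj]
    · refine ⟨?_, rfl, ?_⟩
      · simpa [Zip.list] using h5
      · simp [epsZ]
    · simp only; rw [h4.1, h4.2.1, G.adj_comm]; exact hab

lemma ZTrans_NW (G : SimpleGraph V) (D : Xi V) (z z' : Zip V) (h : ZRel D z)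
    (hs : Relation.TransGen (ZStep G) z z') :
    ∃ D', Relation.TransGen (NW G) D D' ∧ ZRel D' z' := by
  induction hs with
  | single hs =>
    obtain ⟨D', h1, h2⟩ := ZStep_NW G D _ _ h hs
    exact ⟨D', .single h1, h2⟩
  | tail _ hs ih =>
    obtain ⟨D', h1, h2⟩ := ih
    obtain ⟨D'', h3, h4⟩ := ZStep_NW G D' _ _ h2 hs
    exact ⟨D'', h1.tail h3, h4⟩

lemma PL_unique [Nonempty V] {v v' : V ≃ ZMod (Fintype.card V)} {l : List V} (h : PL v l)
    (h' : PL v' l) : v = v' := by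
  have : NeZero (Fintype.card V) := ⟨Fintype.card_ne_zero⟩
  ext x
  have hk : (v x).val < l.length := by rw [h.1]; exact ZMod.val_lt _
  have h1 := List.getElem?_eq_getElem hk
  have h2 := h.2 _ _ h1
  have h3 := h'.2 _ _ h1
  rw [ZMod.natCast_zmod_val] at h2 h3
  rw [v.injective h2] at h3
  rw [h3]

lemma ZRel_unique [Nonempty V] {D D' : Xi V} {z : Zip V} (h : ZRel D z) (h' : ZRel D' z) :
    D = D' := by
  obtain ⟨v, i, e⟩ := D
  obtain ⟨v', i', e'⟩ := D'
  obtain ⟨h1, h2, h3⟩ := h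
  obtain ⟨h1', h2', h3'⟩ := h'
  have := PL_unique h1 h1'
  simp only at this h2 h2' h3 h3'
  subst this h2 h2'
  have : i = i' := by
    split_ifs at h3 h3'
    · rw [h3, h3']
    · exact add_right_cancel (h3.trans h3'.symm)
  rw [this]

lemma exists_ZRel [Nonempty V] (z : Zip V) (h1 : z.list.length = Fintype.card V)
    (h2 : ∀ x, x ∈ z.list) : ∃ D, ZRel D z := by
  have : NeZero (Fintype.card V) := ⟨Fintype.card_ne_zero⟩
  let g : ZMod (Fintype.card V) → V := fun k => z.list[k.val]'(by rw [h1]; exact ZMod.val_lt _)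
  have hg : Function.Bijective g := by
    rw [Fintype.bijective_iff_surjective_and_card]
    refine ⟨fun x => ?_, ZMod.card _⟩
    obtain ⟨k, hk, e⟩ := List.mem_iff_getElem.mp (h2 x)
    refine ⟨(k : ZMod _), ?_⟩
    simp only [g]
    rw [← e]
    congr 1
    rw [ZMod.val_natCast, Nat.mod_eq_of_lt (by omega)]
  refine ⟨((Equiv.ofBijective g hg).symm, if z.2.2.2 then z.1.length else z.1.length - 1, z.2.2.2),
    ⟨h1, fun k x hk => ?_⟩, rfl, ?_⟩
  · obtain ⟨hk, e⟩ := List.getElem?_eq_some_iff.mp hk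
    rw [Equiv.symm_apply_eq, Equiv.ofBijective_apply]
    simp only [g]
    rw [← e]
    congr 1
    rw [ZMod.val_natCast, Nat.mod_eq_of_lt (by omega)]
  · cases z.2.2.2 <;> simp

lemma zero_of_zip [Nonempty V] (G : SimpleGraph V) (z : Zip V)
    (h1 : z.list.length = Fintype.card V) (h2 : ∀ x, x ∈ z.list)
    (h3 : Relation.TransGen (ZStep G) z z) : ∃ D, WindingVectorZero G D := by
  obtain ⟨D, hD⟩ := exists_ZRel z h1 h2
  obtain ⟨D', h4, h5⟩ := ZTrans_NW G D z z hD h3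
  rw [ZRel_unique h5 hD] at h4
  exact ⟨D, wind_zero G D h4⟩
end Confine
section Trace
variable {V : Type*} [Fintype V]

lemma pass_right (G : SimpleGraph V) (a : V) (X : List V) : ∀ (L R : List V),
    (∀ x ∈ X, ¬ G.Adj a x) →
    Relation.ReflTransGen (ZStep G) (L, a, X ++ R, true) (X.reverse ++ L, a, R, true) := by
  induction X with
  | nil => intro L R _; exact .refl
  | cons b X ih =>
    intro L R h
    refine .head (ZStep.rn L a b (X ++ R) (h b (by simp))) ?_
    have := ih (b :: L) R (fun x hx => h x (by simp [hx]))
    simpa using this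

lemma pass_left (G : SimpleGraph V) (a : V) (X : List V) : ∀ (L R : List V),
    (∀ x ∈ X, ¬ G.Adj a x) →
    Relation.ReflTransGen (ZStep G) (X ++ L, a, R, false) (L, a, X.reverse ++ R, false) := by
  induction X with
  | nil => intro L R _; exact .refl
  | cons b X ih =>
    intro L R h
    refine .head (ZStep.ln (X ++ L) a b R (h b (by simp))) ?_
    have := ih L (b :: R) (fun x hx => h x (by simp [hx]))
    simpa using this

def Ev (c : ℤ → V) (s l : ℕ) : List V := (List.range' s l).map (fun i : ℕ => c (2 * (i : ℤ)))
def Od (c : ℤ → V) (s l : ℕ) : List V := (List.range' s l).map (fun i : ℕ => c (2 * (i : ℤ) + 1))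

def SS (c : ℤ → V) (m j : ℕ) (T : List V) : Zip V :=
  ((Ev c 0 (j+1)).reverse, c (2 * j + 1),
    Od c (j+1) (m-1-j) ++ Od c 0 j ++ Ev c (j+1) (m-j) ++ T, true)

structure IndCyc (G : SimpleGraph V) (m : ℕ) (c : ℤ → V) : Prop where
  adj : ∀ i, G.Adj (c i) (c (i+1))
  per : ∀ i, c (i + (2 * m + 1)) = c i
  chord : ∀ i d : ℤ, 1 < d → d < 2 * m → ¬ G.Adj (c i) (c (i + d))

lemma IndCyc.nadj {G : SimpleGraph V} {m : ℕ} {c : ℤ → V} (h : IndCyc G m c) (i j : ℤ)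
    (h0 : i - j ≠ 1) (h1 : j - i ≠ 1) (h2 : i - j < 2 * m) (h3 : j - i < 2 * m) :
    ¬ G.Adj (c i) (c j) := by
  rcases lt_trichotomy i j with hh | hh | hh
  · have := h.chord i (j - i) (by omega) h3
    rwa [add_sub_cancel] at this
  · rw [hh]; exact G.loopless.irrefl _
  · have := h.chord j (i - j) (by omega) h2
    rw [add_sub_cancel] at this
    rwa [G.adj_comm]

lemma IndCyc.shift {G : SimpleGraph V} {m : ℕ} {c : ℤ → V} (h : IndCyc G m c) (s : ℤ) :
    IndCyc G m (fun i => c (i + s)) where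
  adj i := by have := h.adj (i + s); rwa [add_right_comm] at this
  per i := by have := h.per (i + s); rwa [add_right_comm] at this
  chord i d h1 h2 := by have := h.chord (i + s) d h1 h2; rwa [add_right_comm] at this

lemma mem_Ev {c : ℤ → V} {s l : ℕ} {x : V} :
    x ∈ Ev c s l ↔ ∃ i : ℕ, s ≤ i ∧ i < s + l ∧ c (2 * i) = x := by
  simp [Ev, List.mem_range']
  constructor
  · rintro ⟨i, hi, h⟩; exact ⟨s + i, by omega, by omega, by push_cast; exact h⟩
  · rintro ⟨i, h1, h2, h⟩
    refine ⟨i - s, by omega, ?_⟩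
    rw [← h]; congr 1; omega

lemma mem_Od {c : ℤ → V} {s l : ℕ} {x : V} :
    x ∈ Od c s l ↔ ∃ i : ℕ, s ≤ i ∧ i < s + l ∧ c (2 * i + 1) = x := by
  simp [Od, List.mem_range']
  constructor
  · rintro ⟨i, hi, h⟩; exact ⟨s + i, by omega, by omega, by push_cast; exact h⟩
  · rintro ⟨i, h1, h2, h⟩
    refine ⟨i - s, by omega, ?_⟩
    rw [← h]; congr 1; omega

lemma Ev_cons (c : ℤ → V) (s l : ℕ) : Ev c s (l+1) = c (2 * s) :: Ev c (s+1) l := by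
  simp [Ev, List.range'_succ]
lemma Od_cons (c : ℤ → V) (s l : ℕ) : Od c s (l+1) = c (2 * s + 1) :: Od c (s+1) l := by
  simp [Od, List.range'_succ]
lemma Ev_concat (c : ℤ → V) (l : ℕ) : Ev c 0 (l+1) = Ev c 0 l ++ [c (2 * l)] := by
  simp [Ev, List.range'_concat]
lemma Od_concat (c : ℤ → V) (l : ℕ) : Od c 0 (l+1) = Od c 0 l ++ [c (2 * l + 1)] := by
  simp [Od, List.range'_concat]

/-- first half of a round -/
lemma half (G : SimpleGraph V) (m : ℕ) (c : ℤ → V) (h : IndCyc G m c) (T : List V) (j : ℕ)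
    (hj : j < m) : Relation.TransGen (ZStep G) (SS c m j T)
      ((Od c 0 j).reverse ++ ((Od c (j+1) (m-1-j)).reverse ++ (Ev c 0 (j+1)).reverse),
        c (2 * j + 2), c (2 * j + 1) :: (Ev c (j+2) (m-j-1) ++ T), false) := by
  obtain ⟨r, rfl⟩ : ∃ r, m = j + r + 1 := ⟨m - j - 1, by omega⟩
  unfold SS
  have e1 : j + r + 1 - j = r + 1 := by omega
  have e2 : j + r + 1 - 1 - j = r := by omega
  have e3 : r + 1 - 1 = r := rfl
  rw [e1, e2, e3]
  refine .tail' ?_ (ZStep.ra _ _ _ _ ?_)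
  · have := pass_right G (c (2 * j + 1)) (Od c (j+1) r ++ Od c 0 j) (Ev c 0 (j+1)).reverse
      (Ev c (j+1) (r+1) ++ T) ?_
    · have e5 : Ev c (j+1) (r+1) = c (2 * j + 2) :: Ev c (j+2) r := by
        rw [Ev_cons]; push_cast; rw [mul_add, mul_one]
      rw [e5] at this ⊢
      simpa using this
    · intro x hx
      rw [List.mem_append, mem_Od, mem_Od] at hx
      rcases hx with ⟨i, h1, h2, rfl⟩ | ⟨i, h1, h2, rfl⟩ <;> apply h.nadj <;> omega
  · have := h.adj (2 * j + 1)
    rwa [add_assoc] at this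

lemma oneRound (G : SimpleGraph V) (m : ℕ) (c : ℤ → V) (h : IndCyc G m c) (T : List V) (j : ℕ)
    (hj : j + 1 < m) : Relation.TransGen (ZStep G) (SS c m j T) (SS c m (j+1) T) := by
  refine (half G m c h T j (by omega)).trans ?_
  obtain ⟨r, rfl⟩ : ∃ r, m = j + r + 2 := ⟨m - j - 2, by omega⟩
  unfold SS
  have e1 : j + r + 2 - (j + 1) = r + 1 := by omega
  have e2 : j + r + 2 - 1 - (j + 1) = r := by omega
  have e3 : j + r + 2 - 1 - j = r + 1 := by omega
  have e4 : j + r + 2 - j - 1 = r + 1 := by omega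
  rw [e1, e2, e3, e4]
  have := pass_left G (c (2 * j + 2)) ((Od c 0 j).reverse ++ (Od c (j+2) r).reverse)
    (c (2 * j + 3) :: (Ev c 0 (j+1)).reverse) (c (2 * j + 1) :: (Ev c (j+2) (r+1) ++ T)) ?_
  · have h2 := Relation.TransGen.tail' this (ZStep.la _ _ _ _ ?_)
    · rw [Od_cons c (j+1), Ev_concat c (j+1), Od_concat c j]
      push_cast
      have e5 : 2 * ((j:ℤ) + 1) = 2 * j + 2 := by ring
      have e6 : 2 * (j:ℤ) + 2 + 1 = 2 * j + 3 := by ring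
      rw [e5, e6]
      simpa using h2
    · have := h.adj (2 * j + 2)
      rwa [add_assoc] at this
  · intro x hx
    rw [List.mem_append, List.mem_reverse, List.mem_reverse, mem_Od, mem_Od] at hx
    rcases hx with ⟨i, h1, h2, rfl⟩ | ⟨i, h1, h2, rfl⟩ <;> apply h.nadj <;> omega

lemma last (G : SimpleGraph V) (m : ℕ) (c : ℤ → V) (h : IndCyc G m c) (T : List V)
    (hm : 0 < m) : Relation.TransGen (ZStep G) (SS c m (m-1) T)
      (SS (fun i => c (i + -1)) m 0 T) := by
  obtain ⟨r, rfl⟩ : ∃ r, m = r + 1 := ⟨m - 1, by omega⟩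
  rw [Nat.add_sub_cancel]
  refine (half G (r+1) c h T r (by omega)).trans ?_
  have e1 : r + 1 - 1 - r = 0 := by omega
  have e2 : r + 1 - r - 1 = 0 := by omega
  rw [e1, e2]
  have := pass_left G (c (2 * r + 2)) ((Od c 0 r).reverse ++ (Ev c 1 r).reverse)
    [c (2 * 0)] (c (2 * r + 1) :: T) ?_
  · have h2 := Relation.TransGen.tail' this (ZStep.la _ _ _ _ ?_)
    · have e3 : c (2 * 0 + -1) = c (2 * r + 2) := by
        rw [← h.per]; congr 1; push_cast; ring
      have e4 : Ev (fun i => c (i + -1)) 1 (r + 1) = Od c 0 (r+1) := by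
        unfold Ev Od
        rw [List.range'_eq_map_range, List.range'_eq_map_range, List.map_map, List.map_map]
        apply List.map_congr_left
        intro i _
        simp only [Function.comp]
        congr 1; push_cast; ring
      have e5 : Od (fun i => c (i + -1)) 1 r = Ev c 1 r := by
        unfold Ev Od
        apply List.map_congr_left
        intro i _
        simp
      unfold SS
      simp only [Nat.add_sub_cancel, Nat.sub_zero, zero_add]
      rw [e4, e5, Ev_cons (fun i => c (i + -1)), Od_concat, Ev_cons c]
      simp only [Nat.cast_zero]
      rw [e3]
      simpa [Ev, Od] using h2
    · have := h.adj (-1)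
      rw [← h.per (-1)] at this
      push_cast at this
      convert this using 2
      · ring
      · ring_nf
  · intro x hx
    rw [List.mem_append, List.mem_reverse, List.mem_reverse, mem_Od, mem_Ev] at hx
    rcases hx with ⟨i, h1, h2, rfl⟩ | ⟨i, h1, h2, rfl⟩ <;> apply h.nadj <;> push_cast <;> omega

lemma full (G : SimpleGraph V) (m : ℕ) (c : ℤ → V) (h : IndCyc G m c) (T : List V)
    (hm : 0 < m) : Relation.TransGen (ZStep G) (SS c m 0 T) (SS (fun i => c (i + -1)) m 0 T) := by
  have : ∀ j < m, Relation.ReflTransGen (ZStep G) (SS c m 0 T) (SS c m j T) := by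
    intro j
    induction j with
    | zero => intro _; exact .refl
    | succ j ih => intro hj; exact (ih (by omega)).trans (oneRound G m c h T j hj).to_reflTransGen
  exact .trans_right (this (m-1) (by omega)) (last G m c h T hm)

lemma full_iter (G : SimpleGraph V) (m : ℕ) (c : ℤ → V) (h : IndCyc G m c) (T : List V)
    (hm : 0 < m) (q : ℕ) :
    Relation.TransGen (ZStep G) (SS c m 0 T) (SS (fun i => c (i + -(q + 1 : ℤ))) m 0 T) := by
  induction q with
  | zero => simpa using full G m c h T hm
  | succ q ih =>
    refine ih.trans ?_
    have := full G m _ (h.shift (-(q + 1 : ℤ))) T hm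
    have e : (fun i : ℤ => c (i + -(((q + 1 : ℕ) : ℤ) + 1))) =
        (fun i : ℤ => c (i + -1 + -(q + 1 : ℤ))) := by
      funext i; congr 1; push_cast; ring
    rw [e]; exact this

lemma full_cycle (G : SimpleGraph V) (m : ℕ) (c : ℤ → V) (h : IndCyc G m c) (T : List V)
    (hm : 0 < m) : Relation.TransGen (ZStep G) (SS c m 0 T) (SS c m 0 T) := by
  have := full_iter G m c h T hm (2 * m)
  convert this using 2
  ext i
  rw [← h.per (i + _)]
  congr 1; push_cast; ring

lemma zero_of_cyc (G : SimpleGraph V) (m : ℕ) (c : ℤ → V) (h : IndCyc G m c)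
    (hm : 0 < m) (hinj : Set.InjOn c (Set.Ico 0 (2 * m + 1))) :
    ∃ D, WindingVectorZero G D := by
  have : Nonempty V := ⟨c 0⟩
  let S : Finset V := (Finset.Ico (0 : ℤ) (2 * m + 1)).image c
  have hS : S.card = 2 * m + 1 := by
    rw [Finset.card_image_of_injOn (by simpa using hinj)]
    simp; omega
  have hS' : S.card ≤ Fintype.card V := Finset.card_le_univ S
  refine zero_of_zip G (SS c m 0 (Sᶜ.toList)) ?_ ?_ (full_cycle G m c h _ hm)
  · simp [Zip.list, SS, Ev, Od, Finset.card_compl]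
    omega
  · intro x
    by_cases hx : x ∈ S
    · simp only [S, Finset.mem_image, Finset.mem_Ico] at hx
      obtain ⟨i, ⟨h1, h2⟩, rfl⟩ := hx
      simp only [Zip.list, SS, List.mem_append, List.mem_cons, List.reverse_reverse, mem_Od, mem_Ev]
      rcases Int.even_or_odd' i with ⟨t, rfl | rfl⟩
      · obtain ⟨t, rfl⟩ := Int.eq_ofNat_of_zero_le (show 0 ≤ t by omega)
        by_cases ht : t = 0
        · left; exact ⟨t, by omega, by omega, rfl⟩
        · right; right; left; right; exact ⟨t, by omega, by omega, rfl⟩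
      · obtain ⟨t, rfl⟩ := Int.eq_ofNat_of_zero_le (show 0 ≤ t by omega)
        by_cases ht : t = 0
        · right; left; subst ht; rfl
        · right; right; left; left; left; exact ⟨t, by omega, by omega, rfl⟩
    · simp [Zip.list, SS, hx]

lemma walk_of_seq (G : SimpleGraph V) (c : ℤ → V) (h : ∀ i, G.Adj (c i) (c (i+1))) (i : ℤ)
    (d : ℕ) : ∃ w : G.Walk (c i) (c (i + d)), w.length = d := by
  induction d with
  | zero => exact ⟨(SimpleGraph.Walk.nil).copy rfl (by simp), by simp⟩
  | succ d ih =>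
    obtain ⟨w, hw⟩ := ih
    refine ⟨(w.concat (h _)).copy rfl (by push_cast; rw [add_assoc]), ?_⟩
    simp [hw]

lemma exists_cyc (G : SimpleGraph V) (h : ¬ G.Colorable 2) :
    ∃ m, 0 < m ∧ ∃ c, IndCyc G m c ∧ Set.InjOn c (Set.Ico 0 (2 * m + 1)) := by
  rw [SimpleGraph.two_colorable_iff_forall_loop_even] at h
  push Not at h
  obtain ⟨u0, w0, h0⟩ := h
  have hex : ∃ k, Odd k ∧ ∃ u, ∃ w : G.Walk u u, w.length = k :=
    ⟨_, Nat.not_even_iff_odd.mp (by simpa using h0), u0, w0, rfl⟩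
  obtain ⟨k, ⟨hodd, u, w, hw⟩, hmin⟩ : ∃ k, (Odd k ∧ ∃ u, ∃ w : G.Walk u u, w.length = k) ∧
      ∀ u (w : G.Walk u u), Odd w.length → k ≤ w.length :=
    ⟨Nat.find hex, Nat.find_spec hex, fun u w hw => Nat.find_min' hex ⟨hw, u, w, rfl⟩⟩
  obtain ⟨m, hm⟩ := hodd
  have hm0 : 0 < m := by
    by_contra h1
    have h2 : w.length = 1 := by omega
    have := SimpleGraph.Walk.adj_of_length_eq_one h2
    exact G.loopless.irrefl _ this
  let c : ℤ → V := fun i => w.getVert (i % k).toNat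
  have hper : ∀ i, c (i + k) = c i := by intro i; simp [c]
  have hadj : ∀ i, G.Adj (c i) (c (i+1)) := by
    intro i
    have hb1 : 0 ≤ i % k := Int.emod_nonneg _ (by omega)
    have hb2 : i % k < k := Int.emod_lt_of_pos _ (by omega)
    have h1 := w.adj_getVert_succ (i := (i % k).toNat) (by omega)
    have h2 : c (i+1) = w.getVert ((i % k).toNat + 1) := by
      simp only [c]
      rw [Int.add_emod]
      rw [Int.emod_eq_of_lt (a := 1) (by omega) (by omega)]
      by_cases h3 : i % k + 1 = k
      · rw [h3, Int.emod_self]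
        have : (i % k).toNat + 1 = w.length := by omega
        rw [this]; simp
      · rw [Int.emod_eq_of_lt (by omega) (by omega)]
        congr 1; omega
    rw [h2]; exact h1
  have key : ∀ (i : ℤ) (d : ℕ), 0 < d → d < k → c i ≠ c (i + d) := by
    intro i d h1 h2 he
    obtain ⟨w1, hw1⟩ := walk_of_seq G c hadj i d
    obtain ⟨w2, hw2⟩ := walk_of_seq G c hadj (i + d) (k - d)
    have e : c (i + d + ((k - d : ℕ) : ℤ)) = c i := by
      rw [← hper i]; congr 1; push_cast [h2.le]; ring
    have m1 := hmin _ (w1.copy rfl he.symm)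
    have m2 := hmin _ (w2.copy he.symm e)
    simp only [SimpleGraph.Walk.length_copy, hw1, hw2] at m1 m2
    rcases Nat.even_or_odd d with hd | hd
    · have : Odd (k - d) := by
        obtain ⟨x, hx⟩ := hd
        exact ⟨m - x, by omega⟩
      have := m2 this; omega
    · have := m1 hd; omega
  refine ⟨m, hm0, c, ⟨hadj, fun i => ?_, fun i d h1 h2 ha => ?_⟩, ?_⟩
  · have := hper i; rw [hm] at this; push_cast at this; exact this
  · obtain ⟨d, rfl⟩ := Int.eq_ofNat_of_zero_le (show 0 ≤ d by omega)
    obtain ⟨w1, hw1⟩ := walk_of_seq G c hadj i d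
    obtain ⟨w2, hw2⟩ := walk_of_seq G c hadj (i + d) (k - d)
    have e : c (i + d + ((k - d : ℕ) : ℤ)) = c i := by
      rw [← hper i]; congr 1; push_cast [show d ≤ k by omega]; ring
    have m1 := hmin _ (w1.concat ha.symm)
    have m2 := hmin _ ((w2.copy rfl e).concat ha)
    simp only [SimpleGraph.Walk.length_concat, SimpleGraph.Walk.length_copy, hw1, hw2] at m1 m2
    rcases Nat.even_or_odd d with hd | hd
    · obtain ⟨x, hx⟩ := hd
      have := m1 ⟨x, by omega⟩; omega
    · obtain ⟨x, hx⟩ := hd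
      have := m2 ⟨m - x, by omega⟩; omega
  · intro i hi j hj he
    simp only [Set.mem_Ico] at hi hj
    rcases lt_trichotomy i j with hh | hh | hh
    · have := key i (j - i).toNat (by omega) (by omega)
      rw [show i + ((j - i).toNat : ℤ) = j by omega] at this
      exact absurd he this
    · exact hh
    · have := key j (i - j).toNat (by omega) (by omega)
      rw [show j + ((i - j).toNat : ℤ) = i by omega] at this
      exact absurd he.symm this
end Trace

/-- A simple graph `G` on `n ≥ 3` vertices is expelling if and only if it
is bipartite (i.e. 2-colorable). -/
theorem stmt_0 (n : ℕ) (hn : 3 ≤ n) (G : SimpleGraph (Fin n)) :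
    Expelling G ↔ G.Colorable 2 := by
  have hc : 2 ≤ Fintype.card (Fin n) := by rw [Fintype.card_fin]; omega
  refine ⟨fun h => ?_, expelling_of_col hc G⟩
  by_contra hcol
  obtain ⟨m, hm, c, h1, h2⟩ := exists_cyc G hcol
  obtain ⟨D, hD⟩ := zero_of_cyc G m c h1 hm h2
  exact h D hD
end

section
/- For every n ≥ 3, the complete graph K_n on n vertices is ensnaring. -/
open scoped Classical

/-- The middle position of the three positions visited by the orbit. -/
def midPos {V : Type*} [Fintype V] (D : Xi V) : ZMod (Fintype.card V) :=
  if D.2.2 then D.2.1 else D.2.1 + 1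

/-- Integer position relative to the middle position. -/
noncomputable def pot {V : Type*} [Fintype V] (D : Xi V) (a : V) : ℤ :=
  if D.1 a = midPos D - 1 then -1 else if D.1 a = midPos D + 1 then 1 else 0

lemma disp_eq_pot {V : Type*} [Fintype V] (h1 : (1 : ZMod (Fintype.card V)) ≠ 0)
    (h2 : (2 : ZMod (Fintype.card V)) ≠ 0) (D : Xi V) (a : V) :
    disp D a = pot (theta ⊤ D) a - pot D a := by
  obtain ⟨v, i, e⟩ := D
  have hadj : (⊤ : SimpleGraph V).Adj (v.symm i) (v.symm (i + 1)) := by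
    simp [h1]
  have e1 : i ≠ i + 1 := by simpa using h1
  have e2 : i ≠ i - 1 := by
    intro h; apply h1; linear_combination h
  have e3 : i + 1 ≠ i - 1 := by
    intro h; apply h2; linear_combination h
  have e4 : i + 1 + 1 ≠ i := by
    intro h; apply h2; linear_combination h
  have e5 : i + 1 + 1 ≠ i + 1 := by
    intro h; apply h1; linear_combination h
  have hm : i - 1 + 1 = i := by ring
  have hm' : i + 1 - 1 = i := by ring
  unfold theta
  simp only [hadj, if_true]
  generalize hx : v a = x
  cases e <;>
    simp only [disp, pot, midPos, epsZ, hx, Equiv.trans_apply, Equiv.swap_apply_def, Bool.not_true,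
      Bool.not_false, if_true, Bool.false_eq_true, if_false, sub_neg_eq_add, hm, hm'] <;>
    by_cases c1 : x = i <;> by_cases c2 : x = i + 1 <;> grind

/-- For every `n ≥ 3`, the complete graph `K_n` is ensnaring. -/
theorem stmt_3 (n : ℕ) (hn : 3 ≤ n) :
    Ensnaring (⊤ : SimpleGraph (Fin n)) := by
  intro D a
  have h1 : (1 : ZMod (Fintype.card (Fin n))) ≠ 0 := by
    intro h
    have h' : ((1 : ℕ) : ZMod (Fintype.card (Fin n))) = 0 := by exact_mod_cast h
    rw [ZMod.natCast_eq_zero_iff, Fintype.card_fin] at h'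
    have := Nat.le_of_dvd (by norm_num) h'
    omega
  have h2 : (2 : ZMod (Fintype.card (Fin n))) ≠ 0 := by
    intro h
    have h' : ((2 : ℕ) : ZMod (Fintype.card (Fin n))) = 0 := by exact_mod_cast h
    rw [ZMod.natCast_eq_zero_iff, Fintype.card_fin] at h'
    have := Nat.le_of_dvd (by norm_num) h'
    omega
  unfold windSum
  simp only [disp_eq_pot h1 h2, ← Function.iterate_succ_apply']
  rw [Finset.sum_range_sub (fun k => pot ((theta ⊤)^[k] D) a)]
  rw [Function.iterate_minimalPeriod]
  simp
end
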